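/- Suppose ρ ∈ (0,∞) and c > E[X], and let a be the unique point in ( inf D_I , E[X] ) with ( I(a) + ρ ) / ( a − c ) = I'(a). Then for every x with a ≤ x < c, (c − x) · inf_{y ≤ x} ( ρ + I(y) ) / ( c − y ) = I'(a) · ( x − c ); and for every x < a, (c − x) · inf_{y ≤ x} ( ρ + I(y) ) / ( c − y ) = I(x) + ρ. -/

import Mathlib

open MeasureTheory Filter Set

/-- A supremum of affine functions satisfies the convexity inequality wherever it has real upper
bounds. -/
theorem iSup_affine_combo_le (φ : ℝ → ℝ) {x y u v s t : ℝ} (hs : 0 ≤ s) (ht : 0 ≤ t)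
    (hst : s + t = 1)
    (hx : (⨆ l : ℝ, ((l * x - φ l : ℝ) : EReal)) ≤ (u : EReal))
    (hy : (⨆ l : ℝ, ((l * y - φ l : ℝ) : EReal)) ≤ (v : EReal)) :
    (⨆ l : ℝ, ((l * (s * x + t * y) - φ l : ℝ) : EReal)) ≤ ((s * u + t * v : ℝ) : EReal) := by
  refine iSup_le fun l => EReal.coe_le_coe_iff.2 ?_
  have h1 : l * x - φ l ≤ u := EReal.coe_le_coe_iff.1 (iSup_le_iff.1 hx l)
  have h2 : l * y - φ l ≤ v := EReal.coe_le_coe_iff.1 (iSup_le_iff.1 hy l)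
  obtain rfl : t = 1 - s := by linarith
  nlinarith [mul_le_mul_of_nonneg_left h1 hs, mul_le_mul_of_nonneg_left h2 ht]

theorem integrable_of_integrable_exp_mul {Ω : Type*} [MeasurableSpace Ω] {P : Measure Ω}
    {X : Ω → ℝ} (hX : Measurable X)
    (hmgf : ∀ l : ℝ, Integrable (fun ω => Real.exp (l * X ω)) P) : Integrable X P := by
  refine ((hmgf 1).add (hmgf (-1))).mono' hX.aestronglyMeasurable (ae_of_all _ fun ω => ?_)
  have h1 := Real.add_one_le_exp (X ω)
  have h2 := Real.add_one_le_exp (-X ω)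
  have h3 := Real.exp_pos (X ω)
  have h4 := Real.exp_pos (-X ω)
  simp only [Real.norm_eq_abs, Pi.add_apply, one_mul, neg_one_mul]
  exact abs_le.2 ⟨by linarith, by linarith⟩

/-- Jensen's inequality for the cumulant generating function. -/
theorem mul_integral_le_log_integral_exp {Ω : Type*} [MeasurableSpace Ω] {P : Measure Ω}
    [IsProbabilityMeasure P] {X : Ω → ℝ} (hX : Measurable X)
    (hmgf : ∀ l : ℝ, Integrable (fun ω => Real.exp (l * X ω)) P) (l : ℝ) :
    l * ∫ ω, X ω ∂P ≤ Real.log (∫ ω, Real.exp (l * X ω) ∂P) := by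
  have hint := (integrable_of_integrable_exp_mul hX hmgf).const_mul l
  have h : Real.exp (∫ ω, l * X ω ∂P) ≤ ∫ ω, Real.exp (l * X ω) ∂P :=
    convexOn_exp.map_integral_le Real.continuous_exp.continuousOn isClosed_univ
      (ae_of_all _ fun _ => mem_univ _) hint (hmgf l)
  rw [integral_const_mul] at h
  exact (Real.le_log_iff_exp_le ((Real.exp_pos _).trans_le h)).2 h

/-- The infimum of `(ρ + J y) / (c - y)` over `y ≤ x` is `k` when `k` is a lower bound at the points
where `J` is finite and is attained at some `z ≤ x`. -/
theorem iInf_add_mul_inv_eq {J : ℝ → EReal} {Jr : ℝ → ℝ} {ρ c x z k : ℝ} (hxc : x < c)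
    (hJ : ∀ y, J y = ⊤ ∨ J y = (Jr y : EReal)) (hzx : z ≤ x) (hz : J z = (Jr z : EReal))
    (hk : ρ + Jr z = k * (c - z))
    (hle : ∀ y ≤ x, J y = (Jr y : EReal) → k * (c - y) ≤ ρ + Jr y) :
    (⨅ (y : ℝ) (_ : y ≤ x), ((ρ : EReal) + J y) * (((c - y)⁻¹ : ℝ) : EReal)) = (k : EReal) := by
  refine le_antisymm (iInf₂_le_of_le z hzx ?_) (le_iInf₂ fun y hy => ?_)
  · have hcz : c - z ≠ 0 := by linarith
    rw [hz, ← EReal.coe_add, ← EReal.coe_mul, hk, mul_inv_cancel_right₀ hcz]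
  · have hcy : 0 < c - y := by linarith
    rcases hJ y with h | h
    · rw [h, EReal.coe_add_top, EReal.top_mul_coe_of_pos (inv_pos.2 hcy)]
      exact le_top
    · rw [h, ← EReal.coe_add, ← EReal.coe_mul, EReal.coe_le_coe_iff, ← div_eq_mul_inv,
        le_div_iff₀ hcy]
      exact hle y hy h

/-- Let `f` be convex with tangent slope `d` at `a`, the tangent of `ρ + f` at `a` passing through
`(c, 0)`. Then `(ρ + f) / (c - ·)` decreases to the left of `a`. -/
theorem ConvexOn.add_mul_sub_le_of_tangent {S : Set ℝ} {f : ℝ → ℝ} (hf : ConvexOn ℝ S f)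
    {a c d ρ x y : ℝ} (ha : a ∈ S) (hy : y ∈ S) (hyx : y ≤ x) (hxa : x < a) (hac : a < c)
    (htan : f a + ρ = d * (a - c)) (hbelow : d * (y - c) ≤ ρ + f y) :
    (ρ + f x) * (c - y) ≤ (ρ + f y) * (c - x) := by
  have hay : 0 < a - y := by linarith
  have hconv := hf.2 hy ha
    (div_nonneg (sub_nonneg.2 hxa.le) hay.le) (div_nonneg (sub_nonneg.2 hyx) hay.le)
    (by field_simp; ring)
  have hxeq : (a - x) / (a - y) * y + (x - y) / (a - y) * a = x := by field_simp; ring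
  simp only [smul_eq_mul] at hconv
  rw [hxeq, div_mul_eq_mul_div, div_mul_eq_mul_div, ← add_div, le_div_iff₀ hay] at hconv
  have hkey : 0 ≤ ((x - y) * (c - a)) * (ρ + f y - d * (y - c)) :=
    mul_nonneg (mul_nonneg (by linarith) (by linarith)) (by linarith)
  have hscaled := mul_le_mul_of_nonneg_right hconv (show 0 ≤ c - y by linarith)
  obtain rfl : ρ = d * (a - c) - f a := by linarith
  refine le_of_mul_le_mul_left ?_ hay
  nlinarith

theorem ConvexOn.add_deriv_mul_sub_le {S : Set ℝ} {f : ℝ → ℝ} (hf : ConvexOn ℝ S f)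
    {a y : ℝ} (ha : a ∈ S) (hy : y ∈ S) (hd : DifferentiableAt ℝ f a) :
    f a + deriv f a * (y - a) ≤ f y := by
  rcases lt_trichotomy y a with h | rfl | h
  · have := hf.slope_le_of_hasDerivAt hy ha h hd.hasDerivAt
    rw [slope_def_field, div_le_iff₀ (by linarith)] at this
    linarith
  · simp
  · have := hf.le_slope_of_hasDerivAt ha hy h hd.hasDerivAt
    rw [slope_def_field, le_div_iff₀ (by linarith)] at this
    linarith

/-- For `ρ ∈ (0,∞)`, `c > E[X]`, and `a` the unique point of `(inf D_I, E[X])` with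
`(I(a) + ρ)/(a − c) = I'(a)`: for `a ≤ x < c`,
`(c − x)·inf_{y ≤ x} (ρ + I(y))/(c − y) = I'(a)·(x − c)`, and for `x < a`,
`(c − x)·inf_{y ≤ x} (ρ + I(y))/(c − y) = I(x) + ρ`. -/
theorem lower_deviation_rate_evaluation
    {Ω : Type*} [MeasurableSpace Ω] (P : Measure Ω) [IsProbabilityMeasure P]
    (X : Ω → ℝ) (hXmeas : Measurable X)
    (hnondeg : ∀ t : ℝ, P {ω | X ω = t} < 1)
    (hmgf : ∀ l : ℝ, Integrable (fun ω => Real.exp (l * X ω)) P)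
    (φ : ℝ → ℝ) (hφ : φ = fun l => Real.log (∫ ω, Real.exp (l * X ω) ∂P))
    (I : ℝ → EReal) (hI : I = fun x => ⨆ l : ℝ, ((l * x - φ l : ℝ) : EReal))
    (DI : Set ℝ) (hDI : DI = {x | I x < ⊤})
    (Ir : ℝ → ℝ) (hIr : Ir = fun x => (I x).toReal)
    (hconv : StrictConvexOn ℝ (interior DI) Ir)
    (hdiff : ∀ x ∈ interior DI, DifferentiableAt ℝ Ir x)
    (EX : ℝ) (hEX : EX = ∫ ω, X ω ∂P)
    (hderivEX : deriv Ir EX = 0)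
    (hderivBot : Filter.Tendsto (deriv Ir) (Filter.atBot ⊓ Filter.principal (interior DI))
      Filter.atBot)
    (ρ : ℝ) (hρ : 0 < ρ) (c : ℝ) (hc : EX < c)
    (a : ℝ) (ha1 : sInf (Real.toEReal '' DI) < (a : EReal)) (ha2 : a < EX)
    (ha3 : (Ir a + ρ) / (a - c) = deriv Ir a) :
    (∀ x : ℝ, a ≤ x → x < c →
      ((c - x : ℝ) : EReal) *
          (⨅ (y : ℝ) (_ : y ≤ x), (((ρ : ℝ) : EReal) + I y) * (((c - y)⁻¹ : ℝ) : EReal))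
        = ((deriv Ir a * (x - c) : ℝ) : EReal)) ∧
    (∀ x : ℝ, x < a →
      ((c - x : ℝ) : EReal) *
          (⨅ (y : ℝ) (_ : y ≤ x), (((ρ : ℝ) : EReal) + I y) * (((c - y)⁻¹ : ℝ) : EReal))
        = I x + ((ρ : ℝ) : EReal)) := by
  have hI0 : ∀ y, 0 ≤ I y := fun y => by
    rw [hI]
    exact le_iSup_of_le 0 (by simp [hφ])
  have hcoe : ∀ y, I y < ⊤ → I y = (Ir y : EReal) := fun y hy => by
    rw [hIr]
    exact (EReal.coe_toReal hy.ne (ne_bot_of_le_ne_bot EReal.zero_ne_bot (hI0 y))).symm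
  have hcombo : ∀ y ∈ DI, ∀ z ∈ DI, ∀ s t : ℝ, 0 ≤ s → 0 ≤ t → s + t = 1 →
      I (s * y + t * z) ≤ ((s * Ir y + t * Ir z : ℝ) : EReal) := by
    intro y hy z hz s t hs ht hst
    have h1 := (hcoe y (by simpa [hDI] using hy)).le
    have h2 := (hcoe z (by simpa [hDI] using hz)).le
    rw [hI] at h1 h2 ⊢
    exact iSup_affine_combo_le φ hs ht hst h1 h2
  have hDIconv : Convex ℝ DI := by
    intro y hy z hz s t hs ht hst
    rw [hDI]
    exact (hcombo y hy z hz s t hs ht hst).trans_lt (EReal.coe_lt_top _)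
  have hmem : ∀ y, y ∈ DI → I y = (Ir y : EReal) := fun y hy => hcoe y (by simpa [hDI] using hy)
  have hIrconv : ConvexOn ℝ DI Ir := by
    refine ⟨hDIconv, fun y hy z hz s t hs ht hst => ?_⟩
    have h := hcombo y hy z hz s t hs ht hst
    have hin := hmem _ (hDIconv hy hz hs ht hst)
    simp only [smul_eq_mul] at hin ⊢
    rwa [hin, EReal.coe_le_coe_iff] at h
  have hEXmem : EX ∈ DI := by
    have h : I EX ≤ 0 := by
      rw [hI]
      refine iSup_le fun l => ?_
      rw [← EReal.coe_zero, EReal.coe_le_coe_iff, hφ, hEX]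
      exact sub_nonpos.2 (mul_integral_le_log_integral_exp hXmeas hmgf l)
    rw [hDI]
    exact h.trans_lt EReal.zero_lt_top
  have ha_int : a ∈ interior DI := by
    obtain ⟨_, ⟨b, hb, rfl⟩, hba⟩ := sInf_lt_iff.1 ha1
    have hsub : Ioo b EX ⊆ DI :=
      Ioo_subset_Icc_self.trans (hDIconv.ordConnected.out hb hEXmem)
    exact interior_maximal hsub isOpen_Ioo ⟨EReal.coe_lt_coe_iff.1 hba, ha2⟩
  have haDI : a ∈ DI := interior_subset ha_int
  have hac : a < c := ha2.trans hc
  have htan : Ir a + ρ = deriv Ir a * (a - c) := (div_eq_iff (by linarith)).1 ha3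
  have htangent : ∀ y ∈ DI, deriv Ir a * (y - c) ≤ ρ + Ir y := fun y hy => by
    have := hIrconv.add_deriv_mul_sub_le haDI hy (hdiff a ha_int)
    linarith
  have hdich : ∀ y, I y = ⊤ ∨ I y = (Ir y : EReal) := fun y =>
    (eq_or_ne (I y) ⊤).imp_right fun h => hcoe y (lt_top_iff_ne_top.2 h)
  have hfin : ∀ y, I y = (Ir y : EReal) → y ∈ DI := fun y hy => by
    rw [hDI, mem_ofPred_eq, hy]
    exact EReal.coe_lt_top _
  refine ⟨fun x hax hxc => ?_, fun x hxa => ?_⟩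
  · rw [iInf_add_mul_inv_eq (k := -deriv Ir a) hxc hdich hax (hmem a haDI) (by linarith)
      fun y _ hIy => by linarith [htangent y (hfin y hIy)], ← EReal.coe_mul]
    congr 1
    ring
  · have hxc : x < c := hxa.trans hac
    have hcx : 0 < c - x := by linarith
    rcases hdich x with hx | hx
    · have htop : ∀ y ≤ x, I y = ⊤ := fun y hyx => by
        refine (hdich y).resolve_right fun hy => ?_
        have hxDI : x ∈ DI := hDIconv.ordConnected.out (hfin y hy) haDI ⟨hyx, hxa.le⟩
        exact EReal.coe_ne_top _ ((hmem x hxDI).symm.trans hx)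
      have hinf : (⨅ (y : ℝ) (_ : y ≤ x), ((ρ : EReal) + I y) * (((c - y)⁻¹ : ℝ) : EReal)) = ⊤ := by
        refine iInf₂_eq_top.2 fun y hy => ?_
        rw [htop y hy, EReal.coe_add_top,
          EReal.top_mul_coe_of_pos (inv_pos.2 (by linarith : 0 < c - y))]
      rw [hinf, hx, EReal.coe_mul_top_of_pos hcx, EReal.top_add_coe]
    · rw [iInf_add_mul_inv_eq (k := (ρ + Ir x) / (c - x)) hxc hdich le_rfl hx
        (div_mul_cancel₀ _ hcx.ne').symm fun y hyx hIy => ?_, hx, ← EReal.coe_mul,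
        ← EReal.coe_add, mul_div_cancel₀ _ hcx.ne', add_comm]
      rw [div_mul_eq_mul_div, div_le_iff₀ hcx]
      exact hIrconv.add_mul_sub_le_of_tangent haDI (hfin y hIy) hyx hxa hac htan
        (htangent y (hfin y hIy))
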